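/- arXiv:1312.7551 — 6 statements merged into one kernel-verified Lean document; each statement's English description precedes it below -/
import Mathlib

section
/- Let d, n be positive integers and let ρ be a d×d complex matrix admitting a decomposition ρ = Σ_{i=1}^{n} μ_i · a_i a_i†, where μ ∈ ℝ^n is a probability vector (all μ_i ≥ 0 and Σ_i μ_i = 1) and each a_i ∈ ℂ^d is a unit vector. Then ρ is Hermitian with trace 1, and the Shannon entropy of its eigenvalue sequence is bounded above by the Shannon entropy of the ensemble weights: Σ_{k=1}^{d} (−λ_k log λ_k) ≤ Σ_{i=1}^{n} (−μ_i log μ_i), where λ_1,…,λ_d are the eigenvalues of ρ (counted with multiplicity). -/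
open Matrix
open scoped BigOperators

/-- Jensen's inequality for `Real.negMulLog` with weights of total mass at most one. -/
lemma Real.sum_mul_negMulLog_le {ι : Type*} [Fintype ι] (w x : ι → ℝ)
    (hw : ∀ k, 0 ≤ w k) (hw1 : ∑ k, w k ≤ 1) (hx : ∀ k, 0 ≤ x k) :
    ∑ k, w k * Real.negMulLog (x k) ≤ Real.negMulLog (∑ k, w k * x k) := by
  have h := Real.concaveOn_negMulLog.map_add_sum_le (t := Finset.univ) (w := w) (p := x)
    (v := 1 - ∑ k, w k) (q := 0) (fun k _ => hw k) (by ring) (fun k _ => hx k)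
    (by linarith) (by simp)
  simpa using h

/-- If two positive rank-one expansions, one along unit vectors and the other along an orthonormal
basis, define the same quadratic form, then the one along the orthonormal basis has the smaller
entropy. -/
lemma OrthonormalBasis.sum_negMulLog_le {ι κ E : Type*} [Fintype ι] [Fintype κ]
    [NormedAddCommGroup E] [InnerProductSpace ℂ E] (b : OrthonormalBasis ι ℂ E)
    (l : ι → ℝ) (μ : κ → ℝ) (A : κ → E) (hμ : ∀ i, 0 ≤ μ i) (hA : ∀ i, ‖A i‖ = 1)
    (h : ∀ x, ∑ i, μ i * ‖inner ℂ (A i) x‖ ^ 2 = ∑ k, l k * ‖inner ℂ (b k) x‖ ^ 2) :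
    ∑ k, Real.negMulLog (l k) ≤ ∑ i, Real.negMulLog (μ i) := by
  classical
  have hl (k : ι) : ∑ i, μ i * ‖inner ℂ (b k) (A i)‖ ^ 2 = l k := by
    have := h (b k)
    simpa [OrthonormalBasis.inner_eq_ite, apply_ite, norm_inner_symm (b k)] using this
  have hterm (k : ι) (i : κ) : 0 ≤ μ i * ‖inner ℂ (b k) (A i)‖ ^ 2 :=
    mul_nonneg (hμ i) (sq_nonneg _)
  have hl0 (k : ι) : 0 ≤ l k := hl k ▸ Finset.sum_nonneg fun i _ => hterm k i
  let w (i : κ) (k : ι) : ℝ := (l k)⁻¹ * (μ i * ‖inner ℂ (b k) (A i)‖ ^ 2)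
  have hw0 (i : κ) (k : ι) : 0 ≤ w i k := mul_nonneg (inv_nonneg.2 (hl0 k)) (hterm k i)
  have hwl (i : κ) : ∑ k, w i k * l k = μ i := by
    have hk (k : ι) : w i k * l k = μ i * ‖inner ℂ (b k) (A i)‖ ^ 2 := by
      rcases eq_or_ne (l k) 0 with hk | hk
      · have := (Finset.sum_eq_zero_iff_of_nonneg fun i _ => hterm k i).1 ((hl k).trans hk) i
          (Finset.mem_univ i)
        rw [this, hk, mul_zero]
      · simp only [w]
        field_simp
    simp_rw [hk, ← Finset.mul_sum, b.sum_sq_norm_inner_right, hA, one_pow, mul_one]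
  have hw1 (i : κ) : ∑ k, w i k ≤ 1 := by
    set s : ℝ := ∑ k, (l k)⁻¹ * ‖inner ℂ (b k) (A i)‖ ^ 2 with hs
    let x : E := ∑ k, (((l k)⁻¹ : ℝ) * inner ℂ (b k) (A i) : ℂ) • b k
    have hbx (k : ι) : inner ℂ (b k) x = ((l k)⁻¹ : ℝ) * inner ℂ (b k) (A i) := by
      simp [x, OrthonormalBasis.inner_eq_ite]
    have hAx : inner ℂ (A i) x = (s : ℂ) := by
      simp only [x, inner_sum, inner_smul_right, hs, Complex.ofReal_sum]
      refine Finset.sum_congr rfl fun k _ => ?_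
      rw [mul_assoc, ← inner_conj_symm (A i) (b k), Complex.mul_conj, Complex.normSq_eq_norm_sq]
      push_cast
      rfl
    have hq : ∑ k, l k * ‖inner ℂ (b k) x‖ ^ 2 = s := by
      refine Finset.sum_congr rfl fun k _ => ?_
      rw [hbx, norm_mul, mul_pow, Complex.norm_real, Real.norm_eq_abs, sq_abs]
      rcases eq_or_ne (l k) 0 with hk | hk
      · simp [hk]
      · field_simp
    have hle : μ i * s ^ 2 ≤ s := by
      have := Finset.single_le_sum (f := fun j => μ j * ‖inner ℂ (A j) x‖ ^ 2)
        (fun j _ => mul_nonneg (hμ j) (sq_nonneg _)) (Finset.mem_univ i)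
      simpa only [h, hq, hAx, Complex.norm_real, Real.norm_eq_abs, sq_abs] using this
    have hws : ∑ k, w i k = μ i * s := by
      rw [hs, Finset.mul_sum]
      exact Finset.sum_congr rfl fun k _ => by simp only [w]; ring
    rw [hws]
    nlinarith [sq_nonneg (μ i * s - 1), mul_le_mul_of_nonneg_left hle (hμ i)]
  calc ∑ k, Real.negMulLog (l k) = ∑ i, ∑ k, w i k * Real.negMulLog (l k) := by
        rw [Finset.sum_comm]
        refine Finset.sum_congr rfl fun k _ => ?_
        rw [← Finset.sum_mul, ← Finset.mul_sum, hl]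
        rcases eq_or_ne (l k) 0 with hk | hk
        · simp [hk]
        · rw [inv_mul_cancel₀ hk, one_mul]
    _ ≤ ∑ i, Real.negMulLog (∑ k, w i k * l k) :=
        Finset.sum_le_sum fun i _ => Real.sum_mul_negMulLog_le _ _ (hw0 i) (hw1 i) hl0
    _ = ∑ i, Real.negMulLog (μ i) := by simp_rw [hwl]

/-- The quadratic form of a Hermitian matrix, diagonalized in its eigenvector basis. -/
lemma Matrix.IsHermitian.inner_toEuclideanLin_self {d : Type*} [Fintype d] [DecidableEq d]
    {M : Matrix d d ℂ} (hM : M.IsHermitian) (x : EuclideanSpace ℂ d) :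
    inner ℂ x (M.toEuclideanLin x) =
      ((∑ k, hM.eigenvalues k * ‖inner ℂ (hM.eigenvectorBasis k) x‖ ^ 2 : ℝ) : ℂ) := by
  have hb (k : d) : M.toEuclideanLin (hM.eigenvectorBasis k) =
      (hM.eigenvalues k : ℂ) • hM.eigenvectorBasis k := by
    ext j
    simpa [toLpLin_apply] using congrFun (hM.mulVec_eigenvectorBasis k) j
  rw [← hM.eigenvectorBasis.sum_inner_mul_inner, Complex.ofReal_sum]
  refine Finset.sum_congr rfl fun k _ => ?_
  rw [← isSymmetric_toEuclideanLin_iff.2 hM, hb, inner_smul_left, Complex.conj_ofReal,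
    mul_left_comm, ← inner_conj_symm x, mul_comm (starRingEnd ℂ _), Complex.mul_conj,
    Complex.normSq_eq_norm_sq]
  push_cast
  rfl

/-- The quadratic form of a real combination of rank-one matrices. -/
lemma Matrix.inner_toEuclideanLin_sum_vecMulVec {d κ : Type*} [Fintype d] [DecidableEq d]
    [Fintype κ] (μ : κ → ℝ) (a : κ → d → ℂ) (x : EuclideanSpace ℂ d) :
    inner ℂ x ((∑ i, μ i • vecMulVec (a i) (star (a i))).toEuclideanLin x) =
      ((∑ i, μ i * ‖inner ℂ (WithLp.toLp 2 (a i)) x‖ ^ 2 : ℝ) : ℂ) := by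
  have hx : (∑ i, μ i • vecMulVec (a i) (star (a i))).toEuclideanLin x =
      ∑ i, ((μ i : ℂ) * inner ℂ (WithLp.toLp 2 (a i)) x) • WithLp.toLp 2 (a i) := by
    ext j
    simp only [toLpLin_apply, sum_mulVec, smul_mulVec, vecMulVec_mulVec,
      EuclideanSpace.inner_eq_star_dotProduct, dotProduct_comm, WithLp.ofLp_sum, WithLp.ofLp_smul,
      Finset.sum_apply, Pi.smul_apply, MulOpposite.smul_eq_mul_unop, MulOpposite.unop_op,
      Complex.real_smul, smul_eq_mul]
    exact Finset.sum_congr rfl fun i _ => by ring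
  rw [hx, inner_sum, Complex.ofReal_sum]
  refine Finset.sum_congr rfl fun i _ => ?_
  rw [inner_smul_right, mul_assoc, ← inner_conj_symm x, Complex.mul_conj,
    Complex.normSq_eq_norm_sq]
  push_cast
  rfl

/-- Jaynes inequality: for a matrix ρ admitting a pure-state ensemble decomposition
ρ = Σ μ_i a_i a_i† with μ a probability vector and each a_i a unit vector, ρ is
Hermitian of trace 1 and the Shannon entropy of its eigenvalues is at most the
Shannon entropy of the ensemble weights. -/
theorem jaynes_inequality (d n : ℕ) (hd : 0 < d) (hn : 0 < n)
    (ρ : Matrix (Fin d) (Fin d) ℂ)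
    (μ : Fin n → ℝ) (a : Fin n → (Fin d → ℂ))
    (hμ0 : ∀ i, 0 ≤ μ i) (hμ1 : ∑ i, μ i = 1)
    (ha : ∀ i, star (a i) ⬝ᵥ a i = 1)
    (hρ : ρ = ∑ i, μ i • Matrix.vecMulVec (a i) (star (a i))) :
    ∃ hherm : ρ.IsHermitian, ρ.trace = 1 ∧
      ∑ k, (-(hherm.eigenvalues k) * Real.log (hherm.eigenvalues k)) ≤
        ∑ i, (-(μ i) * Real.log (μ i)) := by
  have hherm : ρ.IsHermitian := by
    simp [hρ, IsHermitian, conjTranspose_sum, conjTranspose_smul, conjTranspose_vecMulVec]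
  refine ⟨hherm, ?_, ?_⟩
  · simp_rw [hρ, trace_sum, trace_smul, trace_vecMulVec, dotProduct_comm (a _), ha,
      ← Finset.sum_smul, hμ1, one_smul]
  · refine hherm.eigenvectorBasis.sum_negMulLog_le hherm.eigenvalues μ
      (fun i => WithLp.toLp 2 (a i)) hμ0 (fun i => ?_) fun x => ?_
    · have h : inner ℂ (WithLp.toLp 2 (a i)) (WithLp.toLp 2 (a i)) = (1 : ℂ) := by
        rw [EuclideanSpace.inner_eq_star_dotProduct, dotProduct_comm]
        exact ha i
      rw [inner_self_eq_norm_sq_to_K] at h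
      exact (pow_eq_one_iff_of_nonneg (norm_nonneg _) two_ne_zero).1
        (Complex.ofReal_injective (by simpa using h))
    · have h := hherm.inner_toEuclideanLin_self x
      have h' := inner_toEuclideanLin_sum_vecMulVec μ a x
      rw [← hρ] at h'
      exact_mod_cast h'.symm.trans h
end

section
/- Let d be a positive integer and let ρ be a d×d complex Hermitian positive semidefinite matrix with trace 1. Define S(ρ) = Σ_{k=1}^{d} (−λ_k log λ_k), where λ_1,…,λ_d are the eigenvalues of ρ. Then: (a) for every decomposition ρ = Σ_{i=1}^{n} μ_i · a_i a_i† with μ a probability vector and each a_i ∈ ℂ^d a unit vector, one has S(ρ) ≤ Σ_{i=1}^{n} (−μ_i log μ_i); and (b) there exists such a decomposition (with n = d) for which Σ_{i}(−μ_i log μ_i) = S(ρ). Hence S(ρ) is the minimum of the ensemble entropies over all pure-state decompositions of ρ. -/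
open Matrix
open scoped BigOperators ComplexOrder

/-- A diagonal entry of a Hermitian idempotent complex matrix is at most `1`. -/
lemma Matrix.IsHermitian.diag_re_le_one_of_mul_self {n : Type*} [Fintype n] {P : Matrix n n ℂ}
    (hP : P.IsHermitian) (hPP : P * P = P) (i : n) : (P i i).re ≤ 1 := by
  have h : (P i i).re = ∑ j, Complex.normSq (P i j) := by
    conv_lhs => rw [← hPP]
    rw [Matrix.mul_apply, Complex.re_sum]
    refine Finset.sum_congr rfl fun j _ => ?_
    rw [← hP.apply j i, Complex.star_def, Complex.mul_conj, Complex.ofReal_re]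
  have h₁ : Complex.normSq (P i i) ≤ (P i i).re := by
    rw [h]
    exact Finset.single_le_sum (f := fun j => Complex.normSq (P i j))
      (fun j _ => Complex.normSq_nonneg _) (Finset.mem_univ i)
  rw [Complex.normSq_apply] at h₁
  nlinarith [mul_self_nonneg (P i i).im]

/-- Jensen's inequality for `Real.negMulLog` with weights of total mass at most `1`. -/
lemma Real.sum_mul_negMulLog_le_of_sum_le_one {κ : Type*} [Fintype κ] {w x : κ → ℝ}
    (hw : ∀ k, 0 ≤ w k) (hw₁ : ∑ k, w k ≤ 1) (hx : ∀ k, 0 ≤ x k) :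
    ∑ k, w k * Real.negMulLog (x k) ≤ Real.negMulLog (∑ k, w k * x k) := by
  have h := Real.concaveOn_negMulLog.le_map_sum (t := (Finset.univ : Finset (Option κ)))
    (w := fun o => o.elim (1 - ∑ k, w k) w) (p := fun o => o.elim 0 x)
    (by rintro (_ | k) _
        · simpa using hw₁
        · exact hw k)
    (by simp [Fintype.sum_option])
    (by rintro (_ | k) _
        · simp
        · exact hx k)
  simpa [Fintype.sum_option] using h

/-- If `Wᴴ * W` is diagonal, then its diagonal has entropy at most that of the diagonal
of `W * Wᴴ`. -/
lemma sum_negMulLog_le_of_conjTranspose_mul_self_eq_diagonal {ι κ : Type*} [Fintype ι]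
    [Fintype κ] [DecidableEq κ] (W : Matrix ι κ ℂ) {ev : κ → ℝ} {μ : ι → ℝ}
    (hev : ∀ k, 0 ≤ ev k) (hW : Wᴴ * W = diagonal fun k => (ev k : ℂ))
    (hμ : ∀ i, (W * Wᴴ) i i = μ i) :
    ∑ k, Real.negMulLog (ev k) ≤ ∑ i, Real.negMulLog (μ i) := by
  have hcol : ∀ k, ∑ i, Complex.normSq (W i k) = ev k := fun k => by
    have h := congrFun₂ hW k k
    rw [Matrix.mul_apply, diagonal_apply_eq] at h
    apply Complex.ofReal_injective
    rw [← h, Complex.ofReal_sum]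
    refine Finset.sum_congr rfl fun i _ => ?_
    rw [conjTranspose_apply, Complex.star_def, Complex.normSq_eq_conj_mul_self]
  have hrow : ∀ i, ∑ k, Complex.normSq (W i k) = μ i := fun i => by
    apply Complex.ofReal_injective
    rw [← hμ, Matrix.mul_apply, Complex.ofReal_sum]
    refine Finset.sum_congr rfl fun k _ => ?_
    rw [conjTranspose_apply, Complex.star_def, Complex.mul_conj]
  set p : ι → κ → ℝ := fun i k => Complex.normSq (W i k) * (ev k)⁻¹ with hp
  have hp₀ : ∀ i k, 0 ≤ p i k := fun i k =>
    mul_nonneg (Complex.normSq_nonneg _) (inv_nonneg.2 (hev k))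
  have hp₁ : ∀ i, ∑ k, p i k ≤ 1 := fun i => by
    set D : Matrix κ κ ℂ := diagonal fun k => ((ev k)⁻¹ : ℂ) with hD
    have hDH : Dᴴ = D := by
      rw [hD, diagonal_conjTranspose]
      congr 1
      ext k
      simp
    have hH : (W * D * Wᴴ).IsHermitian := by
      simp [Matrix.IsHermitian, conjTranspose_mul, hDH, Matrix.mul_assoc]
    have hDD : D * (Wᴴ * W) * D = D := by
      rw [hW, hD, diagonal_mul_diagonal, diagonal_mul_diagonal]
      congr 1
      ext k
      by_cases h : (ev k : ℂ) = 0
      · simp [h]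
      · field_simp
    have hPP : (W * D * Wᴴ) * (W * D * Wᴴ) = W * D * Wᴴ := by
      conv_rhs => rw [← hDD]
      simp only [Matrix.mul_assoc]
    convert hH.diag_re_le_one_of_mul_self hPP i
    rw [Matrix.mul_apply, Complex.re_sum]
    refine Finset.sum_congr rfl fun k _ => ?_
    rw [hD, mul_diagonal, conjTranspose_apply, Complex.star_def, mul_right_comm,
      Complex.mul_conj, ← Complex.ofReal_inv, ← Complex.ofReal_mul, Complex.ofReal_re]
  have hpev : ∀ i k, p i k * ev k = Complex.normSq (W i k) := fun i k => by
    by_cases h : ev k = 0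
    · have h₀ := hcol k
      rw [h, Finset.sum_eq_zero_iff_of_nonneg fun _ _ => Complex.normSq_nonneg _] at h₀
      rw [h, mul_zero, h₀ i (Finset.mem_univ i)]
    · simp [hp, h]
  calc ∑ k, Real.negMulLog (ev k) = ∑ k, ∑ i, p i k * Real.negMulLog (ev k) := by
        refine Finset.sum_congr rfl fun k _ => ?_
        rw [← Finset.sum_mul, ← Finset.sum_mul, hcol]
        by_cases h : ev k = 0
        · simp [h]
        · rw [mul_inv_cancel₀ h, one_mul]
    _ = ∑ i, ∑ k, p i k * Real.negMulLog (ev k) := Finset.sum_comm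
    _ ≤ ∑ i, Real.negMulLog (μ i) := by
        refine Finset.sum_le_sum fun i _ => ?_
        rw [← hrow i, ← Finset.sum_congr rfl fun k _ => hpev i k]
        exact Real.sum_mul_negMulLog_le_of_sum_le_one (hp₀ i) (hp₁ i) hev

/-- The spectral theorem in the form `Uᴴ * A * U = diagonal`. -/
lemma Matrix.IsHermitian.conjTranspose_eigenvectorUnitary_mul_mul {n : Type*} [Fintype n]
    [DecidableEq n] {A : Matrix n n ℂ} (hA : A.IsHermitian) :
    (hA.eigenvectorUnitary : Matrix n n ℂ)ᴴ * A * (hA.eigenvectorUnitary : Matrix n n ℂ) =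
      diagonal fun k => (hA.eigenvalues k : ℂ) := by
  have h := hA.conjStarAlgAut_star_eigenvectorUnitary
  rw [Unitary.conjStarAlgAut_star_apply] at h
  exact h

/-- The von Neumann entropy of a density matrix is the minimum of the ensemble
(simplicial) entropies over all of its pure-state decompositions: it is a lower
bound for each such decomposition, and it is attained by a decomposition with
`n = d` (the spectral decomposition). -/
theorem vonNeumann_entropy_min_ensemble (d : ℕ) (hd : 0 < d)
    (ρ : Matrix (Fin d) (Fin d) ℂ)
    (hpsd : ρ.PosSemidef) (htr : ρ.trace = 1) :
    (∀ (n : ℕ) (μ : Fin n → ℝ) (a : Fin n → (Fin d → ℂ)),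
      (∀ i, 0 ≤ μ i) → (∑ i, μ i = 1) →
      (∀ i, star (a i) ⬝ᵥ a i = 1) →
      ρ = ∑ i, μ i • Matrix.vecMulVec (a i) (star (a i)) →
      ∑ k, (-(hpsd.isHermitian.eigenvalues k) *
          Real.log (hpsd.isHermitian.eigenvalues k)) ≤
        ∑ i, (-(μ i) * Real.log (μ i))) ∧
    (∃ (μ : Fin d → ℝ) (a : Fin d → (Fin d → ℂ)),
      (∀ i, 0 ≤ μ i) ∧ (∑ i, μ i = 1) ∧
      (∀ i, star (a i) ⬝ᵥ a i = 1) ∧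
      ρ = ∑ i, μ i • Matrix.vecMulVec (a i) (star (a i)) ∧
      ∑ i, (-(μ i) * Real.log (μ i)) =
        ∑ k, (-(hpsd.isHermitian.eigenvalues k) *
          Real.log (hpsd.isHermitian.eigenvalues k))) := by
  set U : Matrix (Fin d) (Fin d) ℂ := hpsd.isHermitian.eigenvectorUnitary.1
  have hUU : U * Uᴴ = 1 := Unitary.coe_mul_star_self _
  have hUU' : Uᴴ * U = 1 := Unitary.coe_star_mul_self _
  have hdiag : Uᴴ * ρ * U = diagonal fun k => (hpsd.isHermitian.eigenvalues k : ℂ) :=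
    hpsd.isHermitian.conjTranspose_eigenvectorUnitary_mul_mul
  refine ⟨fun n μ a hμ _ ha hρ => ?_, hpsd.isHermitian.eigenvalues, fun i j => U j i,
    hpsd.eigenvalues_nonneg, ?_, fun i => ?_, ?_, rfl⟩
  · set A : Matrix (Fin n) (Fin d) ℂ := of fun i j => (√(μ i) : ℂ) * star (a i j) with hAdef
    have hsq : ∀ i, (√(μ i) : ℂ) * √(μ i) = μ i := fun i => by
      rw [← Complex.ofReal_mul, Real.mul_self_sqrt (hμ i)]
    have hAA : Aᴴ * A = ρ := by
      rw [hρ]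
      ext j k
      rw [Matrix.mul_apply, Matrix.sum_apply]
      refine Finset.sum_congr rfl fun i _ => ?_
      simp [hAdef, vecMulVec_apply, ← hsq]
      ring
    refine sum_negMulLog_le_of_conjTranspose_mul_self_eq_diagonal (A * U) (μ := μ)
      hpsd.eigenvalues_nonneg ?_ fun i => ?_
    · rw [← hdiag, ← hAA, conjTranspose_mul]
      simp only [Matrix.mul_assoc]
    · have h : A * U * (A * U)ᴴ = A * Aᴴ := by
        rw [conjTranspose_mul, Matrix.mul_assoc, ← Matrix.mul_assoc U, hUU, Matrix.one_mul]
      rw [h, Matrix.mul_apply, ← hsq, ← mul_one (_ * _), ← ha i, dotProduct, Finset.mul_sum]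
      refine Finset.sum_congr rfl fun j _ => ?_
      simp [hAdef]
      ring
  · have h := hpsd.isHermitian.trace_eq_sum_eigenvalues
    rw [htr] at h
    apply Complex.ofReal_injective
    rw [Complex.ofReal_sum, Complex.ofReal_one]
    exact h.symm
  · simpa [Matrix.mul_apply, dotProduct] using congrFun₂ hUU' i i
  · have h : ρ = U * (diagonal fun k => (hpsd.isHermitian.eigenvalues k : ℂ)) * Uᴴ := by
      rw [← hdiag, Matrix.mul_assoc, Matrix.mul_assoc, Matrix.mul_assoc, hUU, Matrix.mul_one,
        ← Matrix.mul_assoc, hUU, Matrix.one_mul]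
    conv_lhs => rw [h]
    ext j k
    rw [Matrix.mul_apply, Matrix.sum_apply]
    refine Finset.sum_congr rfl fun i _ => ?_
    simp [vecMulVec_apply]
    ring
end

section
/- Let d be a positive integer, let ρ be a d×d complex Hermitian positive semidefinite matrix with trace 1, and let (e_1,…,e_d) and (f_1,…,f_d) be two orthonormal bases of ℂ^d that are mutually unbiased, i.e. |⟨e_i, f_j⟩|² = 1/d for all i, j. Let H₁ = Σ_{i=1}^{d} −p_i log p_i with p_i = ⟨e_i, ρ e_i⟩ (a nonnegative real), let H₂ = Σ_{j=1}^{d} −q_j log q_j with q_j = ⟨f_j, ρ f_j⟩, and let S(ρ) = Σ_{k=1}^{d} −λ_k log λ_k where λ_k are the eigenvalues of ρ. Then H₁ + H₂ ≥ log d + S(ρ). -/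
open Matrix
open scoped BigOperators ComplexOrder

/-- If `f 0 = 1` and `‖f x‖ ≤ exp (a * x)` for small positive `x`, then the real part of the
derivative of `f` at `0` is at most `a`. -/
lemma re_deriv_le_of_norm_le_exp {f : ℂ → ℂ} {f' : ℂ} {a : ℝ} (hf : HasDerivAt f f' 0)
    (h0 : f 0 = 1) (h : ∀ x : ℝ, 0 < x → x < 1 / 2 → ‖f x‖ ≤ Real.exp (a * x)) :
    f'.re ≤ a := by
  have hre : HasDerivAt (fun x : ℝ => (f x).re) f'.re 0 := by
    have hf0 : HasDerivAt f f' ((0 : ℝ) : ℂ) := by simpa using hf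
    exact hf0.real_of_complex
  have hexp : HasDerivAt (fun x : ℝ => Real.exp (a * x)) a 0 := by
    simpa using ((hasDerivAt_id (0 : ℝ)).const_mul a).exp
  refine sub_nonneg.1 (ge_of_tendsto
    ((hexp.sub hre).tendsto_slope.mono_left (nhdsWithin_mono (0 : ℝ) (s := Set.Ioi 0) ?_)) ?_)
  · exact fun x hx => ne_of_gt hx
  filter_upwards [Ioo_mem_nhdsGT (show (0 : ℝ) < 1 / 2 by norm_num)] with x hx
  have := (Complex.re_le_norm (f x)).trans (h x hx.1 hx.2)
  simp only [slope_def_field, Pi.sub_apply, Complex.ofReal_zero, h0, mul_zero, Real.exp_zero,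
    Complex.one_re, sub_self, sub_zero]
  exact div_nonneg (by linarith) hx.1.le

/-- A three lines estimate at the boundary for the derivative of an exponential sum. -/
lemma re_sum_mul_le_log_of_strip {ι : Type*} [Fintype ι] {C : ι → ℂ} {a : ι → ℝ} {c : ℝ}
    (hc : 0 < c) (hC : ∑ s, C s = 1)
    (h0 : ∀ z : ℂ, z.re = 0 → ‖∑ s, C s * Complex.exp (a s * z)‖ ≤ 1)
    (h1 : ∀ z : ℂ, z.re = 1 / 2 → ‖∑ s, C s * Complex.exp (a s * z)‖ ≤ √c) :
    (∑ s, C s * a s).re ≤ Real.log c := by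
  have hd : Differentiable ℂ (fun z : ℂ => ∑ s, C s * Complex.exp (a s * z)) := by fun_prop
  refine re_deriv_le_of_norm_le_exp (f := fun z => ∑ s, C s * Complex.exp (a s * z)) ?_
    (by simpa using hC) fun x hx0 hx1 => ?_
  · refine HasDerivAt.fun_sum fun s _ => ?_
    simpa using (((hasDerivAt_id (0 : ℂ)).const_mul (a s : ℂ)).cexp).const_mul (C s)
  · have hB : BddAbove ((norm ∘ fun z : ℂ => ∑ s, C s * Complex.exp (a s * z)) ''
        Complex.HadamardThreeLines.verticalClosedStrip 0 (1 / 2)) := by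
      refine ⟨∑ s, ‖C s‖ * Real.exp |a s|, ?_⟩
      rintro _ ⟨z, hz, rfl⟩
      refine (norm_sum_le _ _).trans (Finset.sum_le_sum fun s _ => ?_)
      rw [norm_mul, Complex.norm_exp]
      gcongr
      simp only [Complex.re_ofReal_mul]
      have hz' : 0 ≤ z.re ∧ z.re ≤ 1 / 2 := hz
      refine (le_abs_self _).trans ?_
      rw [abs_mul, abs_of_nonneg hz'.1]
      nlinarith [abs_nonneg (a s)]
    have key := Complex.HadamardThreeLines.norm_le_interp_of_mem_verticalClosedStrip'
      (z := (x : ℂ)) (by norm_num : (0 : ℝ) < 1 / 2)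
      (show (x : ℂ).re ∈ Set.Icc (0 : ℝ) (1 / 2) from ⟨hx0.le, hx1.le⟩)
      hd.diffContOnCl hB (fun z hz => h0 z hz) (fun z hz => h1 z hz)
    refine key.trans_eq ?_
    rw [Real.one_rpow, one_mul, Real.rpow_def_of_pos (Real.sqrt_pos.2 hc), Real.log_sqrt hc.le]
    congr 1
    simp
    ring

lemma norm_sq_ite_exp_log {x : ℝ} (hx : 0 ≤ x) {z : ℂ} (hz : z.re = 1 / 2) :
    ‖if x = 0 then 0 else Complex.exp (Real.log x * z)‖ ^ 2 = x := by
  split_ifs with h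
  · simp [h]
  · rw [Complex.norm_exp, ← Real.exp_nat_mul, Complex.re_ofReal_mul, hz]
    convert Real.exp_log (lt_of_le_of_ne hx (Ne.symm h)) using 2
    push_cast
    ring

section UnitaryMatrices

variable {n : Type*} [Fintype n]

lemma trace_conjTranspose_mul_self_eq_sum_norm_sq (X : Matrix n n ℂ) :
    (Xᴴ * X).trace = ((∑ i, ∑ j, ‖X i j‖ ^ 2 : ℝ) : ℂ) := by
  rw [Finset.sum_comm]
  simp [trace, mul_apply, Complex.conj_mul']

variable [DecidableEq n]

/-- The Hilbert–Schmidt norm is unitarily invariant. -/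
lemma sum_norm_sq_unitary_mul_mul_unitary {U W : Matrix n n ℂ} (hU : U ∈ unitaryGroup n ℂ)
    (hW : W ∈ unitaryGroup n ℂ) (X : Matrix n n ℂ) :
    ∑ i, ∑ j, ‖(U * X * W) i j‖ ^ 2 = ∑ i, ∑ j, ‖X i j‖ ^ 2 := by
  rw [← Complex.ofReal_inj, ← trace_conjTranspose_mul_self_eq_sum_norm_sq,
    ← trace_conjTranspose_mul_self_eq_sum_norm_sq]
  have hU' : Uᴴ * U = 1 := mem_unitaryGroup_iff'.1 hU
  have hW' : W * Wᴴ = 1 := mem_unitaryGroup_iff.1 hW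
  calc ((U * X * W)ᴴ * (U * X * W)).trace
      = (Wᴴ * (Xᴴ * (Uᴴ * U) * X * W)).trace := by
        simp only [conjTranspose_mul, Matrix.mul_assoc]
    _ = (Xᴴ * X).trace := by
        rw [trace_mul_comm, hU', Matrix.mul_one, Matrix.mul_assoc, hW', Matrix.mul_one]

lemma diagonal_exp_mem_unitaryGroup (a : n → ℝ) {z : ℂ} (hz : z.re = 0) :
    diagonal (fun i => Complex.exp (a i * z)) ∈ unitaryGroup n ℂ := by
  rw [mem_unitaryGroup_iff, star_eq_conjTranspose, diagonal_conjTranspose, diagonal_mul_diagonal,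
    ← diagonal_one]
  congr 1
  ext i
  rw [Pi.star_apply, RCLike.star_def, Complex.mul_conj', Complex.norm_exp]
  simp [hz]

lemma mul_diagonal_mul_diagonal_mul_apply (U M W : Matrix n n ℂ) (g h : n → ℂ) (k l : n) :
    (U * (diagonal g * M * diagonal h) * W) k l =
      ∑ i, ∑ j, U k i * (g i * M i j * h j) * W j l := by
  simp only [mul_apply (M := U * _), mul_apply (M := U), Finset.sum_mul,
    mul_diagonal, diagonal_mul]
  exact Finset.sum_comm

/-- The entropic uncertainty inequality in coordinates: `U`, `M`, `W` are the transition matrices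
between an eigenbasis of a state with spectrum `l` and two further orthonormal bases. -/
theorem sum_mul_log_add_sub_le_log_of_unitary {U M W : Matrix n n ℂ} (hU : U ∈ unitaryGroup n ℂ)
    (hM : M ∈ unitaryGroup n ℂ) (hW : W ∈ unitaryGroup n ℂ) (hUMW : U * M * W = 1)
    {l p q : n → ℝ} (hl : ∀ k, 0 ≤ l k) (hl1 : ∑ k, l k = 1)
    (hp : ∀ i, p i = ∑ k, l k * ‖U k i‖ ^ 2) (hq : ∀ j, q j = ∑ k, l k * ‖W j k‖ ^ 2)
    {c : ℝ} (hc : 0 < c) (hMc : ∀ i j, ‖M i j‖ ^ 2 ≤ c) :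
    ∑ i, p i * Real.log (p i) + ∑ j, q j * Real.log (q j) - ∑ k, l k * Real.log (l k) ≤
      Real.log c := by
  have hp0 : ∀ i, 0 ≤ p i := fun i => by
    rw [hp]; exact Finset.sum_nonneg fun k _ => mul_nonneg (hl k) (sq_nonneg _)
  have hq0 : ∀ j, 0 ≤ q j := fun j => by
    rw [hq]; exact Finset.sum_nonneg fun k _ => mul_nonneg (hl k) (sq_nonneg _)
  have hUrow : ∀ k, ∑ i, ‖U k i‖ ^ 2 = 1 := fun k => by
    have := congrFun₂ (mem_unitaryGroup_iff.1 hU) k k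
    simp only [mul_apply, star_apply, RCLike.star_def, Complex.mul_conj', one_apply_eq] at this
    exact_mod_cast this
  have hWcol : ∀ k, ∑ j, ‖W j k‖ ^ 2 = 1 := fun k => by
    have := congrFun₂ (mem_unitaryGroup_iff'.1 hW) k k
    simp only [mul_apply, star_apply, RCLike.star_def, Complex.conj_mul', one_apply_eq] at this
    exact_mod_cast this
  have hp1 : ∑ i, p i = 1 := by
    simp_rw [hp]; rw [Finset.sum_comm]; simp_rw [← Finset.mul_sum, hUrow, mul_one, hl1]
  have hq1 : ∑ j, q j = 1 := by
    simp_rw [hq]; rw [Finset.sum_comm]; simp_rw [← Finset.mul_sum, hWcol, mul_one, hl1]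
  have hpU : ∀ i k, p i = 0 → (l k : ℂ) * U k i = 0 := fun i k h => by
    rw [hp, Finset.sum_eq_zero_iff_of_nonneg
      fun k _ => mul_nonneg (hl k) (sq_nonneg _)] at h
    simpa using h k (Finset.mem_univ k)
  have hqW : ∀ j k, q j = 0 → (l k : ℂ) * W j k = 0 := fun j k h => by
    rw [hq, Finset.sum_eq_zero_iff_of_nonneg
      fun k _ => mul_nonneg (hl k) (sq_nonneg _)] at h
    simpa using h k (Finset.mem_univ k)
  have hMW : M * W = star U := by
    rw [← one_mul (M * W), ← mem_unitaryGroup_iff'.1 hU, mul_assoc, ← mul_assoc U, hUMW, mul_one]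
  have hUM : U * M = star W := by
    rw [← mul_one (U * M), ← mem_unitaryGroup_iff.1 hW, ← mul_assoc, hUMW, one_mul]
  have hMW' : ∀ i k, ∑ j, M i j * W j k = star (U k i) := fun i k => by
    rw [← mul_apply, hMW, star_apply]
  have hUM' : ∀ k j, ∑ i, U k i * M i j = star (W j k) := fun k j => by
    rw [← mul_apply, hUM, star_apply]
  let C : n × n × n → ℂ := fun s => l s.1 * (U s.1 s.2.1 * M s.2.1 s.2.2 * W s.2.2 s.1)
  let a : n × n × n → ℝ := fun s => Real.log (p s.2.1) + Real.log (q s.2.2) - Real.log (l s.1)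
  have hUsum : ∀ φ : n → n → ℂ, ∑ s : n × n × n, C s * φ s.1 s.2.1 =
      ∑ k, ∑ i, l k * ‖U k i‖ ^ 2 * φ k i := fun φ => by
    simp only [Fintype.sum_prod_type, C]
    refine Finset.sum_congr rfl fun k _ => Finset.sum_congr rfl fun i _ => ?_
    rw [← Complex.mul_conj', ← RCLike.star_def, ← hMW', Finset.mul_sum, Finset.mul_sum,
      Finset.sum_mul]
    exact Finset.sum_congr rfl fun j _ => by ring
  have hWsum : ∀ φ : n → ℂ, ∑ s : n × n × n, C s * φ s.2.2 =
      ∑ k, ∑ j, l k * ‖W j k‖ ^ 2 * φ j := fun φ => by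
    simp only [Fintype.sum_prod_type, C]
    refine Finset.sum_congr rfl fun k _ => ?_
    rw [Finset.sum_comm]
    refine Finset.sum_congr rfl fun j _ => ?_
    rw [← Complex.mul_conj', ← RCLike.star_def, ← hUM', Finset.mul_sum, Finset.mul_sum,
      Finset.sum_mul]
    exact Finset.sum_congr rfl fun i _ => by ring
  have hUrow' : ∀ k, ∑ i, (‖U k i‖ : ℂ) ^ 2 = 1 := fun k => by exact_mod_cast hUrow k
  have hl1' : ∑ k, (l k : ℂ) = 1 := by exact_mod_cast hl1
  have hC : ∑ s, C s = 1 := by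
    simpa [← Finset.mul_sum, hUrow', hl1'] using hUsum fun _ _ => 1
  have hderiv : ∑ s, C s * a s = ((∑ i, p i * Real.log (p i) + ∑ j, q j * Real.log (q j) -
      ∑ k, l k * Real.log (l k) : ℝ) : ℂ) := by
    simp only [a, Complex.ofReal_sub, Complex.ofReal_add, mul_sub, mul_add,
      Finset.sum_sub_distrib, Finset.sum_add_distrib]
    rw [hUsum fun _ i => (Real.log (p i) : ℂ), hWsum fun j => (Real.log (q j) : ℂ),
      hUsum fun k _ => (Real.log (l k) : ℂ)]
    congr 1
    · congr 1
      · rw [Finset.sum_comm]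
        push_cast
        refine Finset.sum_congr rfl fun i _ => ?_
        rw [← Finset.sum_mul]
        congr 1
        rw [hp]; push_cast; rfl
      · rw [Finset.sum_comm]
        push_cast
        refine Finset.sum_congr rfl fun i _ => ?_
        rw [← Finset.sum_mul]
        congr 1
        rw [hq]; push_cast; rfl
    · push_cast
      refine Finset.sum_congr rfl fun k _ => ?_
      rw [← Finset.sum_mul, ← Finset.mul_sum, hUrow', mul_one]
  have hfactor : ∀ (z : ℂ) (g h : n → ℂ),
      (∀ i, p i ≠ 0 → g i = Complex.exp (Real.log (p i) * z)) →
      (∀ j, q j ≠ 0 → h j = Complex.exp (Real.log (q j) * z)) →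
      ∑ s, C s * Complex.exp (a s * z) = ∑ k, l k * Complex.exp (-(Real.log (l k) * z)) *
        (U * (diagonal g * M * diagonal h) * W) k k := fun z g h hg hh => by
    simp only [mul_diagonal_mul_diagonal_mul_apply, Fintype.sum_prod_type, Finset.mul_sum, C, a]
    refine Finset.sum_congr rfl fun k _ => Finset.sum_congr rfl fun i _ =>
      Finset.sum_congr rfl fun j _ => ?_
    by_cases hi : p i = 0
    · linear_combination (M i j * W j k * Complex.exp _ -
        Complex.exp (-(Real.log (l k) * z)) * (g i * M i j * h j) * W j k) * hpU i k hi
    by_cases hj : q j = 0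
    · linear_combination (U k i * M i j * Complex.exp _ -
        Complex.exp (-(Real.log (l k) * z)) * U k i * (g i * M i j * h j)) * hqW j k hj
    rw [hg i hi, hh j hj, Complex.ofReal_sub, Complex.ofReal_add, sub_mul, add_mul,
      sub_eq_add_neg, Complex.exp_add, Complex.exp_add]
    ring
  rw [← Complex.ofReal_re (_ - _), ← hderiv]
  refine re_sum_mul_le_log_of_strip hc hC (fun z hz => ?_) fun z hz => ?_
  · rw [hfactor z _ _ (fun _ _ => rfl) fun _ _ => rfl, ← hl1]
    refine (norm_sum_le _ _).trans (Finset.sum_le_sum fun k _ => ?_)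
    have hV := entry_norm_bound_of_unitary (mul_mem (mul_mem hU (mul_mem (mul_mem
      (diagonal_exp_mem_unitaryGroup (fun i => Real.log (p i)) hz) hM)
      (diagonal_exp_mem_unitaryGroup (fun j => Real.log (q j)) hz))) hW) k k
    rw [norm_mul, norm_mul, Complex.norm_exp, Complex.norm_of_nonneg (hl k)]
    simpa [hz] using mul_le_mul_of_nonneg_left hV (hl k)
  · rw [hfactor z (fun i => if p i = 0 then 0 else Complex.exp (Real.log (p i) * z))
      (fun j => if q j = 0 then 0 else Complex.exp (Real.log (q j) * z))
      (fun i hi => if_neg hi) fun j hj => if_neg hj]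
    set g := fun i => if p i = 0 then 0 else Complex.exp (Real.log (p i) * z)
    set h := fun i => if q i = 0 then 0 else Complex.exp (Real.log (q i) * z)
    have hg2 : ∀ i, ‖g i‖ ^ 2 = p i := fun i => norm_sq_ite_exp_log (hp0 i) hz
    have hh2 : ∀ i, ‖h i‖ ^ 2 = q i := fun i => norm_sq_ite_exp_log (hq0 i) hz
    set A := U * (diagonal g * M * diagonal h) * W with hA
    have hA2 : ∑ k, ‖A k k‖ ^ 2 ≤ c := calc
      _ ≤ ∑ k, ∑ j, ‖A k j‖ ^ 2 := Finset.sum_le_sum fun k _ =>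
        Finset.single_le_sum (f := fun j => ‖A k j‖ ^ 2) (fun _ _ => sq_nonneg _)
          (Finset.mem_univ k)
      _ = ∑ i, ∑ j, p i * ‖M i j‖ ^ 2 * q j := by
        rw [hA, sum_norm_sq_unitary_mul_mul_unitary hU hW]
        simp only [mul_diagonal, diagonal_mul, norm_mul, mul_pow, hg2, hh2]
      _ ≤ ∑ i, ∑ j, p i * c * q j := by
        gcongr with i _ j _
        · exact hq0 j
        · exact hp0 i
        · exact hMc i j
      _ = c := by simp_rw [← Finset.mul_sum, ← Finset.sum_mul, hq1, hp1]; ring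
    have hl2 : ∀ k, ‖(l k : ℂ) * Complex.exp (-(Real.log (l k) * z))‖ ^ 2 = l k := fun k => by
      rcases (hl k).eq_or_lt with hk | hk
      · simp [← hk]
      · rw [norm_mul, Complex.norm_exp, Complex.norm_of_nonneg hk.le, Complex.neg_re,
          Complex.re_ofReal_mul, hz, mul_pow, ← Real.exp_nat_mul,
          show ((2 : ℕ) : ℝ) * -(Real.log (l k) * (1 / 2)) = -Real.log (l k) by push_cast; ring,
          Real.exp_neg, Real.exp_log hk]
        field_simp
    refine (norm_sum_le _ _).trans (Real.le_sqrt_of_sq_le ?_)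
    simp_rw [norm_mul _ (A _ _)]
    refine (Finset.sum_mul_sq_le_sq_mul_sq _ _ _).trans ?_
    simp_rw [hl2, hl1, one_mul]
    exact hA2

lemma of_mem_unitaryGroup_of_orthonormal {e : n → n → ℂ}
    (he : ∀ i j, star (e i) ⬝ᵥ e j = if i = j then 1 else 0) : (of e)ᵀ ∈ unitaryGroup n ℂ := by
  rw [mem_unitaryGroup_iff']
  ext i j
  rw [one_apply, ← he]
  rfl

/-- A diagonal entry of a matrix with spectral decomposition `V diag(l) Vᴴ`. -/
lemma star_dotProduct_mulVec_eq_sum (V : Matrix n n ℂ) (l : n → ℝ) (x : n → ℂ) :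
    star x ⬝ᵥ (V * diagonal (fun k => (l k : ℂ)) * Vᴴ) *ᵥ x =
      ((∑ k, l k * ‖(Vᴴ *ᵥ x) k‖ ^ 2 : ℝ) : ℂ) := by
  rw [← mulVec_mulVec, ← mulVec_mulVec, dotProduct_mulVec,
    ← conjTranspose_conjTranspose V, ← star_mulVec, conjTranspose_conjTranspose]
  simp only [dotProduct, mulVec_diagonal, Pi.star_apply, RCLike.star_def]
  push_cast
  refine Finset.sum_congr rfl fun k _ => ?_
  rw [← Complex.conj_mul']
  ring

end UnitaryMatrices

/-- Entropic uncertainty inequality for two mutually unbiased bases: if ρ is a density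
matrix on ℂ^d and (e_i), (f_j) are mutually unbiased orthonormal bases, then the sum of
the chart entropies of the diagonal distributions of ρ in the two bases is at least
log d plus the von Neumann entropy of ρ. -/
theorem mub_entropic_uncertainty (d : ℕ) (hd : 0 < d)
    (ρ : Matrix (Fin d) (Fin d) ℂ)
    (hpsd : ρ.PosSemidef) (htr : ρ.trace = 1)
    (e f : Fin d → (Fin d → ℂ))
    (he : ∀ i j, star (e i) ⬝ᵥ e j = if i = j then 1 else 0)
    (hf : ∀ i j, star (f i) ⬝ᵥ f j = if i = j then 1 else 0)
    (hmub : ∀ i j, Complex.normSq (star (e i) ⬝ᵥ f j) = 1 / d)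
    (p q : Fin d → ℝ)
    (hp : ∀ i, (p i : ℂ) = star (e i) ⬝ᵥ ρ *ᵥ e i)
    (hq : ∀ j, (q j : ℂ) = star (f j) ⬝ᵥ ρ *ᵥ f j) :
    Real.log d +
        ∑ k, (-(hpsd.isHermitian.eigenvalues k) *
          Real.log (hpsd.isHermitian.eigenvalues k)) ≤
      (∑ i, (-(p i) * Real.log (p i))) + (∑ j, (-(q j) * Real.log (q j))) := by
  set l := hpsd.isHermitian.eigenvalues
  let V : Matrix (Fin d) (Fin d) ℂ := hpsd.isHermitian.eigenvectorUnitary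
  have hV : V ∈ unitaryGroup (Fin d) ℂ := hpsd.isHermitian.eigenvectorUnitary.2
  have hspec : ρ = V * diagonal (fun k => (l k : ℂ)) * Vᴴ := by
    conv_lhs => rw [hpsd.isHermitian.spectral_theorem, Unitary.conjStarAlgAut_apply]
    rfl
  have hE := of_mem_unitaryGroup_of_orthonormal he
  have hF := of_mem_unitaryGroup_of_orthonormal hf
  have hVs : Vᴴ ∈ unitaryGroup (Fin d) ℂ := Unitary.star_mem hV
  have hl1 : ∑ k, l k = 1 := by
    have := hpsd.isHermitian.trace_eq_sum_eigenvalues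
    rw [htr] at this
    exact Complex.ofReal_injective (by push_cast; exact this.symm)
  have hprod : Vᴴ * (of e)ᵀ * (star (of e)ᵀ * (of f)ᵀ) * (star (of f)ᵀ * V) = 1 := calc
    _ = Vᴴ * ((of e)ᵀ * star (of e)ᵀ) * ((of f)ᵀ * star (of f)ᵀ) * V := by
      simp only [mul_assoc]
    _ = 1 := by
      rw [mem_unitaryGroup_iff.1 hE, mem_unitaryGroup_iff.1 hF, mul_one, mul_one]
      exact mem_unitaryGroup_iff'.1 hV
  have key := sum_mul_log_add_sub_le_log_of_unitary (mul_mem hVs hE)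
    (mul_mem (Unitary.star_mem hE) hF) (mul_mem (Unitary.star_mem hF) hV) hprod
    (l := l) (p := p) (q := q) (c := 1 / d) hpsd.eigenvalues_nonneg hl1
    (fun i => ?_) (fun j => ?_) (by positivity) (fun i j => ?_)
  · rw [one_div, Real.log_inv] at key
    simp only [neg_mul, Finset.sum_neg_distrib]
    linarith
  · rw [← Complex.ofReal_inj, hp, hspec, star_dotProduct_mulVec_eq_sum]
    rfl
  · rw [← Complex.ofReal_inj, hq, hspec, star_dotProduct_mulVec_eq_sum]
    have hadj : star (of f)ᵀ * V = star (Vᴴ * (of f)ᵀ) := by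
      rw [star_mul, ← star_eq_conjTranspose, star_star]
    simp only [hadj, star_apply, norm_star]
    rfl
  · rw [← hmub i j, Complex.normSq_eq_norm_sq]
    rfl
end

section
/- Let r be a positive integer, let u be an r×r doubly stochastic matrix (u_{ij} ≥ 0 for all i,j, every row sums to 1, and every column sums to 1), and let λ ∈ ℝ^r be a probability vector. Define μ ∈ ℝ^r by μ_i = Σ_{j=1}^{r} u_{ij} λ_j. Then μ is a probability vector and Σ_{i=1}^{r} (−μ_i log μ_i) ≥ Σ_{j=1}^{r} (−λ_j log λ_j). -/
open scoped BigOperators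

/-- Mixing by a matrix whose columns sum to one preserves the total mass. -/
theorem sum_sum_mul_eq_sum_of_col_sum_one {ι κ R : Type*} [Fintype ι] [Fintype κ]
    [NonAssocSemiring R] (u : ι → κ → R) (hcol : ∀ j, ∑ i, u i j = 1) (v : κ → R) :
    ∑ i, ∑ j, u i j * v j = ∑ j, v j := by
  rw [Finset.sum_comm]
  simp_rw [← Finset.sum_mul, hcol, one_mul]

/-- Jensen's inequality for a concave function summed over a doubly stochastic mixing. -/
theorem ConcaveOn.sum_le_sum_doublyStochastic {ι : Type*} [Fintype ι] {s : Set ℝ} {f : ℝ → ℝ}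
    (hf : ConcaveOn ℝ s f) (u : ι → ι → ℝ) (hu : ∀ i j, 0 ≤ u i j)
    (hrow : ∀ i, ∑ j, u i j = 1) (hcol : ∀ j, ∑ i, u i j = 1)
    (v : ι → ℝ) (hv : ∀ j, v j ∈ s) :
    ∑ j, f (v j) ≤ ∑ i, f (∑ j, u i j * v j) := by
  rw [← sum_sum_mul_eq_sum_of_col_sum_one u hcol fun j ↦ f (v j)]
  exact Finset.sum_le_sum fun i _ ↦
    hf.le_map_sum (fun j _ ↦ hu i j) (hrow i) fun j _ ↦ hv j

/-- Mixing a probability vector by a doubly stochastic matrix does not decrease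
its Shannon entropy: if μ_i = Σ_j u_{ij} λ_j with u doubly stochastic and λ a
probability vector, then μ is a probability vector and H(μ) ≥ H(λ). -/
theorem doublyStochastic_entropy_mono
    (r : ℕ) (hr : 0 < r) (u : Matrix (Fin r) (Fin r) ℝ)
    (hu0 : ∀ i j, 0 ≤ u i j)
    (hrow : ∀ i, ∑ j, u i j = 1) (hcol : ∀ j, ∑ i, u i j = 1)
    (lam : Fin r → ℝ) (hl0 : ∀ j, 0 ≤ lam j) (hl1 : ∑ j, lam j = 1)
    (μ : Fin r → ℝ) (hμ : ∀ i, μ i = ∑ j, u i j * lam j) :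
    ((∀ i, 0 ≤ μ i) ∧ ∑ i, μ i = 1) ∧
      ∑ j, (-(lam j) * Real.log (lam j)) ≤ ∑ i, (-(μ i) * Real.log (μ i)) := by
  obtain rfl : μ = fun i ↦ ∑ j, u i j * lam j := funext hμ
  refine ⟨⟨fun i ↦ Finset.sum_nonneg fun j _ ↦ mul_nonneg (hu0 i j) (hl0 j), ?_⟩, ?_⟩
  · rw [sum_sum_mul_eq_sum_of_col_sum_one u hcol lam, hl1]
  · exact Real.concaveOn_negMulLog.sum_le_sum_doublyStochastic u hu0 hrow hcol lam hl0
end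

section
/- Let d, n, r be positive integers and let ρ be a d×d complex matrix with two decompositions ρ = Σ_{i=1}^{n} μ_i · a_i a_i† = Σ_{j=1}^{r} λ_j · e_j e_j†, where μ ∈ ℝ^n is a probability vector, each a_i ∈ ℂ^d is a unit vector, the vectors e_1,…,e_r ∈ ℂ^d are orthonormal, and λ_j > 0 for all j. Then there exists a matrix U : ℂ^{n×r} with orthonormal columns (Σ_{i=1}^{n} conj(U_{ij}) U_{ij'} = δ_{jj'} for all j, j') such that √μ_i · a_i = Σ_{j=1}^{r} U_{ij} · √λ_j · e_j for every i; consequently μ_i = Σ_{j=1}^{r} |U_{ij}|² λ_j for every i, with Σ_{i=1}^{n} |U_{ij}|² = 1 for every j. -/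
open Matrix
open scoped BigOperators

open scoped ComplexOrder in
/-- If `A * Aᴴ = B * Bᴴ` and `S` is a left inverse of `B`, then `S * A` is a coisometry through
which `A` factors over `B`. -/
theorem Matrix.coisometry_of_mul_conjTranspose_eq {𝕜 m n r : Type*} [RCLike 𝕜] [Fintype m]
    [DecidableEq m] [Fintype n] [Fintype r] [DecidableEq r] {A : Matrix m n 𝕜} {B : Matrix m r 𝕜}
    {S : Matrix r m 𝕜} (h : A * Aᴴ = B * Bᴴ) (hS : S * B = 1) :
    (S * A) * (S * A)ᴴ = 1 ∧ B * (S * A) = A := by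
  constructor
  · calc (S * A) * (S * A)ᴴ = S * (A * Aᴴ) * Sᴴ := by
          simp only [conjTranspose_mul, Matrix.mul_assoc]
      _ = (S * B) * (S * B)ᴴ := by rw [h]; simp only [conjTranspose_mul, Matrix.mul_assoc]
      _ = 1 := by rw [hS, conjTranspose_one, Matrix.one_mul]
  · have h0 : (1 - B * S) * (A * Aᴴ) = 0 := by
      rw [h, Matrix.sub_mul, Matrix.one_mul, Matrix.mul_assoc B S, ← Matrix.mul_assoc S B, hS,
        Matrix.one_mul, sub_self]
    rw [mul_self_mul_conjTranspose_eq_zero] at h0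
    rw [Matrix.sub_mul, Matrix.one_mul, Matrix.mul_assoc] at h0
    exact (sub_eq_zero.mp h0).symm

/-- The weighted sum of the rank-one matrices `v i (v i)†` is the Gram product of the matrix whose
columns are the `v i` scaled by the square roots of the weights. -/
theorem Matrix.sum_smul_vecMulVec_star {m n : Type*} [Fintype n] (w : n → ℝ) (hw : ∀ i, 0 ≤ w i)
    (v : n → m → ℂ) :
    ∑ i, w i • vecMulVec (v i) (star (v i)) =
      (of fun k i => (√(w i) : ℂ) * v i k) * (of fun k i => (√(w i) : ℂ) * v i k)ᴴ := by
  ext k l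
  rw [Matrix.sum_apply, Matrix.mul_apply]
  refine Finset.sum_congr rfl fun i _ => ?_
  have hs : (w i : ℂ) = √(w i) * √(w i) := by
    rw [← Complex.ofReal_mul, Real.mul_self_sqrt (hw i)]
  simp only [smul_apply, vecMulVec_apply, Pi.star_apply, Complex.real_smul, conjTranspose_apply,
    of_apply, star_mul', Complex.star_def, Complex.conj_ofReal, hs]
  ring

/-- Schrödinger–HJW mixture theorem: any pure-state ensemble decomposition
ρ = Σ μ_i a_i a_i† of a matrix is related to an orthonormal decomposition
ρ = Σ λ_j e_j e_j† (with λ_j > 0) by an n×r matrix U with orthonormal columns: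
√μ_i a_i = Σ_j U_{ij} √λ_j e_j; consequently μ_i = Σ_j |U_{ij}|² λ_j and
Σ_i |U_{ij}|² = 1. -/
theorem ensemble_unitary_connection
    (d n r : ℕ) (hd : 0 < d) (hn : 0 < n) (hr : 0 < r)
    (ρ : Matrix (Fin d) (Fin d) ℂ)
    (μ : Fin n → ℝ) (a : Fin n → (Fin d → ℂ))
    (lam : Fin r → ℝ) (e : Fin r → (Fin d → ℂ))
    (hμ0 : ∀ i, 0 ≤ μ i) (hμ1 : ∑ i, μ i = 1)
    (ha : ∀ i, star (a i) ⬝ᵥ a i = 1)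
    (he : ∀ j j', star (e j) ⬝ᵥ e j' = if j = j' then 1 else 0)
    (hlam : ∀ j, 0 < lam j)
    (hρ1 : ρ = ∑ i, μ i • Matrix.vecMulVec (a i) (star (a i)))
    (hρ2 : ρ = ∑ j, lam j • Matrix.vecMulVec (e j) (star (e j))) :
    ∃ U : Matrix (Fin n) (Fin r) ℂ,
      (∀ j j', ∑ i, star (U i j) * U i j' = if j = j' then 1 else 0) ∧
      (∀ i, (Real.sqrt (μ i) : ℂ) • a i =
        ∑ j, U i j • ((Real.sqrt (lam j) : ℂ) • e j)) ∧
      (∀ i, μ i = ∑ j, Complex.normSq (U i j) * lam j) ∧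
      (∀ j, ∑ i, Complex.normSq (U i j) = 1) := by
  set A : Matrix (Fin d) (Fin n) ℂ := of fun k i => (√(μ i) : ℂ) * a i k with hA
  set B : Matrix (Fin d) (Fin r) ℂ := of fun k j => (√(lam j) : ℂ) * e j k with hB
  set S : Matrix (Fin r) (Fin d) ℂ := of fun j k => (√(lam j) : ℂ)⁻¹ * star (e j k) with hS
  have hAB : A * Aᴴ = B * Bᴴ := by
    rw [hA, hB, ← sum_smul_vecMulVec_star μ hμ0 a,
      ← sum_smul_vecMulVec_star lam (fun j => (hlam j).le) e, ← hρ1, ← hρ2]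
  have hsqrt : ∀ j, (√(lam j) : ℂ) ≠ 0 := fun j =>
    Complex.ofReal_ne_zero.mpr (Real.sqrt_pos.mpr (hlam j)).ne'
  have hBB : ∀ j j', ∑ k, star (e j k) * e j' k = if j = j' then 1 else 0 := he
  have hSB : S * B = 1 := by
    ext j j'
    calc (S * B) j j' = (√(lam j) : ℂ)⁻¹ * √(lam j') * ∑ k, star (e j k) * e j' k := by
          rw [Matrix.mul_apply, Finset.mul_sum]
          refine Finset.sum_congr rfl fun k _ => ?_
          simp only [hS, hB, of_apply]
          ring
      _ = (1 : Matrix (Fin r) (Fin r) ℂ) j j' := by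
          rw [hBB, Matrix.one_apply]
          split_ifs with h
          · rw [← h, inv_mul_cancel₀ (hsqrt j), one_mul]
          · rw [mul_zero]
  obtain ⟨hW, hBW⟩ := coisometry_of_mul_conjTranspose_eq hAB hSB
  set W := S * A
  have hWW : ∀ j j', ∑ i, star (W j i) * W j' i = if j = j' then 1 else 0 := by
    intro j j'
    have h := congrFun (congrFun hW j') j
    rw [Matrix.mul_apply, Matrix.one_apply] at h
    simp only [conjTranspose_apply] at h
    simpa only [mul_comm, eq_comm] using h
  refine ⟨Wᵀ, hWW, fun i => ?_, fun i => ?_, fun j => ?_⟩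
  · ext k
    have h := congrFun (congrFun hBW k) i
    rw [Matrix.mul_apply] at h
    simp only [hA, hB, of_apply] at h
    simp only [Pi.smul_apply, Finset.sum_apply, smul_eq_mul, transpose_apply]
    rw [← h]
    exact Finset.sum_congr rfl fun j _ => mul_comm _ _
  · have hAA : (Aᴴ * A) i i = μ i := by
      calc (Aᴴ * A) i i = (√(μ i) : ℂ) * √(μ i) * (star (a i) ⬝ᵥ a i) := by
            rw [Matrix.mul_apply, dotProduct, Finset.mul_sum]
            refine Finset.sum_congr rfl fun k _ => ?_
            simp only [hA, conjTranspose_apply, of_apply, star_mul', Complex.star_def,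
              Complex.conj_ofReal, Pi.star_apply]
            ring
        _ = μ i := by rw [ha, mul_one, ← Complex.ofReal_mul, Real.mul_self_sqrt (hμ0 i)]
    have hBdiag : Bᴴ * B = diagonal fun j => (lam j : ℂ) := by
      ext j j'
      calc (Bᴴ * B) j j' = (√(lam j) : ℂ) * √(lam j') * ∑ k, star (e j k) * e j' k := by
            rw [Matrix.mul_apply, Finset.mul_sum]
            refine Finset.sum_congr rfl fun k _ => ?_
            simp only [hB, conjTranspose_apply, of_apply, star_mul', Complex.star_def,
              Complex.conj_ofReal]
            ring
        _ = diagonal (fun j => (lam j : ℂ)) j j' := by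
            rw [hBB, diagonal_apply]
            split_ifs with h
            · rw [← h, mul_one, ← Complex.ofReal_mul, Real.mul_self_sqrt (hlam j).le]
            · rw [mul_zero]
    have hfactor : Aᴴ * A = Wᴴ * (diagonal (fun j => (lam j : ℂ)) * W) := by
      rw [← hBdiag, ← hBW]
      simp only [conjTranspose_mul, Matrix.mul_assoc]
    rw [hfactor, Matrix.mul_apply] at hAA
    apply Complex.ofReal_injective
    rw [← hAA, Complex.ofReal_sum]
    refine Finset.sum_congr rfl fun j _ => ?_
    rw [Complex.ofReal_mul, Complex.normSq_eq_conj_mul_self, diagonal_mul, conjTranspose_apply,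
      transpose_apply, Complex.star_def]
    ring
  · apply Complex.ofReal_injective
    have h := hWW j j
    rw [if_pos rfl] at h
    rw [Complex.ofReal_sum, Complex.ofReal_one, ← h]
    exact Finset.sum_congr rfl fun i _ => Complex.normSq_eq_conj_mul_self
end

section
/- For every real θ, the binary Shannon entropies of the distributions ((1+cos θ)/2, (1−cos θ)/2) and ((1+sin θ)/2, (1−sin θ)/2) satisfy h((1+cos θ)/2) + h((1+sin θ)/2) ≥ log 2, where h(x) = −x log x − (1−x) log(1−x) for x ∈ [0,1] with the convention 0·log 0 = 0. -/
/-- The binary entropy minus the parabola through its values at `0`, `1/2` and `1`. -/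
noncomputable def entropyGap (p : ℝ) : ℝ :=
  Real.binEntropy p - 4 * Real.log 2 * (p * (1 - p))

theorem continuous_entropyGap : Continuous entropyGap := by
  unfold entropyGap
  fun_prop

theorem entropyGap_one_sub (p : ℝ) : entropyGap (1 - p) = entropyGap p := by
  simp only [entropyGap, Real.binEntropy_one_sub]
  ring

theorem entropyGap_one : entropyGap 1 = 0 := by
  simp [entropyGap]

theorem entropyGap_one_half : entropyGap (1 / 2) = 0 := by
  rw [entropyGap, one_div, Real.binEntropy_two_inv]
  ring

theorem hasDerivAt_entropyGap {p : ℝ} (h0 : p ≠ 0) (h1 : p ≠ 1) :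
    HasDerivAt entropyGap
      (Real.log (1 - p) - Real.log p - 4 * Real.log 2 * (1 - 2 * p)) p := by
  refine (Real.hasDerivAt_binEntropy h0 h1).sub ?_
  refine (((hasDerivAt_id p).mul ((hasDerivAt_id p).const_sub 1)).const_mul _).congr_deriv ?_
  simp only [id]
  ring

theorem hasDerivAt_deriv_entropyGap {p : ℝ} (h0 : p ≠ 0) (h1 : p ≠ 1) :
    HasDerivAt (fun q => Real.log (1 - q) - Real.log q - 4 * Real.log 2 * (1 - 2 * q))
      (8 * Real.log 2 - 1 / (p * (1 - p))) p := by
  have h2 : 1 - p ≠ 0 := sub_ne_zero.2 h1.symm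
  refine (((((hasDerivAt_id p).const_sub 1).log h2).sub (Real.hasDerivAt_log h0)).sub
    ((((hasDerivAt_id p).const_mul 2).const_sub 1).const_mul _)).congr_deriv ?_
  simp only [id]
  field_simp
  ring

theorem convexOn_entropyGap {a b : ℝ} (ha : 0 ≤ a) (hb : b ≤ 1)
    (h : ∀ p ∈ Set.Ioo a b, 1 ≤ 8 * Real.log 2 * (p * (1 - p))) :
    ConvexOn ℝ (Set.Icc a b) entropyGap := by
  refine convexOn_of_hasDerivWithinAt2_nonneg
    (f' := fun q => Real.log (1 - q) - Real.log q - 4 * Real.log 2 * (1 - 2 * q))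
    (f'' := fun p => 8 * Real.log 2 - 1 / (p * (1 - p)))
    (convex_Icc a b) continuous_entropyGap.continuousOn ?_ ?_ ?_ <;>
    rw [interior_Icc] <;> intro p hp
  · exact (hasDerivAt_entropyGap (ha.trans_lt hp.1).ne'
      (hp.2.trans_le hb).ne).hasDerivWithinAt
  · exact (hasDerivAt_deriv_entropyGap (ha.trans_lt hp.1).ne'
      (hp.2.trans_le hb).ne).hasDerivWithinAt
  · have hpos : 0 < p * (1 - p) :=
      mul_pos (by linarith [hp.1]) (by linarith [hp.2])
    rw [sub_nonneg, div_le_iff₀ hpos]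
    exact h p hp

theorem concaveOn_entropyGap {a b : ℝ} (ha : 0 ≤ a) (hb : b ≤ 1)
    (h : ∀ p ∈ Set.Ioo a b, 8 * Real.log 2 * (p * (1 - p)) ≤ 1) :
    ConcaveOn ℝ (Set.Icc a b) entropyGap := by
  refine concaveOn_of_hasDerivWithinAt2_nonpos
    (f' := fun q => Real.log (1 - q) - Real.log q - 4 * Real.log 2 * (1 - 2 * q))
    (f'' := fun p => 8 * Real.log 2 - 1 / (p * (1 - p)))
    (convex_Icc a b) continuous_entropyGap.continuousOn ?_ ?_ ?_ <;>
    rw [interior_Icc] <;> intro p hp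
  · exact (hasDerivAt_entropyGap (ha.trans_lt hp.1).ne'
      (hp.2.trans_le hb).ne).hasDerivWithinAt
  · exact (hasDerivAt_deriv_entropyGap (ha.trans_lt hp.1).ne'
      (hp.2.trans_le hb).ne).hasDerivWithinAt
  · have hpos : 0 < p * (1 - p) :=
      mul_pos (by linarith [hp.1]) (by linarith [hp.2])
    rw [sub_nonpos, le_div_iff₀ hpos]
    exact h p hp

/-- The inflection point of `entropyGap` in `[1/2, 1]`. -/
theorem exists_entropyGap_inflection :
    ∃ c : ℝ, 1 / 2 ≤ c ∧ c ≤ 1 ∧ 8 * Real.log 2 * (c * (1 - c)) = 1 := by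
  have hlog : 1 / 2 < Real.log 2 := by linarith [Real.log_two_gt_d9]
  have hcont : ContinuousOn (fun c : ℝ => 8 * Real.log 2 * (c * (1 - c))) (Set.Icc (1 / 2) 1) := by
    fun_prop
  obtain ⟨c, hc, h⟩ := intermediate_value_Icc' (by norm_num) hcont
    (show (1 : ℝ) ∈ Set.Icc _ _ from ⟨by norm_num, by linarith⟩)
  exact ⟨c, hc.1, hc.2, h⟩

theorem entropyGap_nonneg_of_one_half_le {p : ℝ} (hp : 1 / 2 ≤ p) (hp1 : p ≤ 1) :
    0 ≤ entropyGap p := by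
  obtain ⟨c, hc, hc1, hinfl⟩ := exists_entropyGap_inflection
  have hlog : 0 < Real.log 2 := Real.log_pos one_lt_two
  have hmid : ∀ q, 1 / 2 ≤ q → q ≤ c → 0 ≤ entropyGap q := by
    intro q hq hqc
    have hconv : ConvexOn ℝ (Set.Icc (1 - c) c) entropyGap := by
      refine convexOn_entropyGap (by linarith) hc1 fun r hr => ?_
      refine hinfl.ge.trans (mul_le_mul_of_nonneg_left ?_ (by positivity))
      nlinarith [mul_nonneg (sub_nonneg.2 hr.1.le) (sub_nonneg.2 hr.2.le)]
    have h := hconv.2 (show q ∈ Set.Icc (1 - c) c from ⟨by linarith, hqc⟩)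
      (show 1 - q ∈ Set.Icc (1 - c) c from ⟨by linarith, by linarith⟩)
      (show (0 : ℝ) ≤ 1 / 2 by norm_num) (show (0 : ℝ) ≤ 1 / 2 by norm_num) (by norm_num)
    rw [entropyGap_one_sub, show (1 / 2 : ℝ) • q + (1 / 2 : ℝ) • (1 - q) = 1 / 2 by
      simp only [smul_eq_mul]; ring, entropyGap_one_half] at h
    simp only [smul_eq_mul] at h
    linarith
  rcases le_total p c with hpc | hcp
  · exact hmid p hp hpc
  · have hconc : ConcaveOn ℝ (Set.Icc c 1) entropyGap := by
      refine concaveOn_entropyGap (by linarith) le_rfl fun r hr => ?_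
      refine (mul_le_mul_of_nonneg_left ?_ (by positivity)).trans hinfl.le
      nlinarith [mul_nonneg (sub_nonneg.2 hr.1.le) (show 0 ≤ r + c - 1 by linarith [hr.1])]
    refine le_trans ?_ (hconc.min_le_of_mem_Icc (Set.left_mem_Icc.2 hc1)
      (Set.right_mem_Icc.2 hc1) ⟨hcp, hp1⟩)
    exact le_min (hmid c hc le_rfl) entropyGap_one.ge

/-- The binary entropy dominates the parabola `4 p (1 - p) log 2` on the unit interval. -/
theorem four_mul_log_two_mul_le_binEntropy {p : ℝ} (hp0 : 0 ≤ p) (hp1 : p ≤ 1) :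
    4 * Real.log 2 * (p * (1 - p)) ≤ Real.binEntropy p := by
  suffices 0 ≤ entropyGap p from sub_nonneg.1 this
  rcases le_total (1 / 2) p with h | h
  · exact entropyGap_nonneg_of_one_half_le h hp1
  · rw [← entropyGap_one_sub]
    exact entropyGap_nonneg_of_one_half_le (by linarith) (by linarith)

theorem log_two_mul_one_sub_sq_le_entropy {x : ℝ} (h0 : -1 ≤ x) (h1 : x ≤ 1) :
    Real.log 2 * (1 - x ^ 2) ≤
      -((1 + x) / 2) * Real.log ((1 + x) / 2) - ((1 - x) / 2) * Real.log ((1 - x) / 2) := by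
  have h := four_mul_log_two_mul_le_binEntropy (p := (1 + x) / 2) (by linarith) (by linarith)
  rw [Real.binEntropy_eq_negMulLog_add_negMulLog_one_sub,
    show 1 - (1 + x) / 2 = (1 - x) / 2 by ring] at h
  simp only [Real.negMulLog] at h
  linarith

/-- Entropic uncertainty for a pure qubit state in two mutually unbiased bases:
h((1+cos θ)/2) + h((1+sin θ)/2) ≥ log 2, where h(x) = −x log x − (1−x) log(1−x). -/
theorem qubit_mub_entropy_bound (θ : ℝ) :
    Real.log 2 ≤
      ((-((1 + Real.cos θ) / 2) * Real.log ((1 + Real.cos θ) / 2))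
        - ((1 - Real.cos θ) / 2) * Real.log ((1 - Real.cos θ) / 2))
      + ((-((1 + Real.sin θ) / 2) * Real.log ((1 + Real.sin θ) / 2))
        - ((1 - Real.sin θ) / 2) * Real.log ((1 - Real.sin θ) / 2)) := by
  have hc := log_two_mul_one_sub_sq_le_entropy (Real.neg_one_le_cos θ) (Real.cos_le_one θ)
  have hs := log_two_mul_one_sub_sq_le_entropy (Real.neg_one_le_sin θ) (Real.sin_le_one θ)
  have hsum : Real.log 2 * (1 - Real.cos θ ^ 2) + Real.log 2 * (1 - Real.sin θ ^ 2)
      = Real.log 2 := by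
    linear_combination -Real.log 2 * Real.sin_sq_add_cos_sq θ
  linarith
end
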